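/- Given constants C₁, C₂ > 0 and s ∈ (0,1), there exists a nonnegative function G : ℝ → [0,∞), smooth and compactly supported, with G(x) ≤ C₁ for all x ∈ ℝ, and such that (−Δ)^s G(x) ≤ −C₂ |x|^{−(1+2s)} for all x with distance at least 1 from the support of G. -/

import Mathlib

open MeasureTheory

/-- given C₁, C₂ > 0 and s ∈ (0,1), there is a smooth, compactly supported
G : ℝ → [0,∞) with G ≤ C₁ and (−Δ)^s G(x) ≤ −C₂|x|^{−(1+2s)} whenever x is at distance
at least 1 from the support of G.  (For such x no principal value is needed and
(−Δ)^s G(x) = σ_s ∫ (G(x)−G(y))/|x−y|^{1+2s} dy.) -/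
theorem stmt11 (s σ C₁ C₂ : ℝ) (hs1 : 0 < s) (hs2 : s < 1) (hσ : 0 < σ)
    (hC₁ : 0 < C₁) (hC₂ : 0 < C₂) :
    ∃ G : ℝ → ℝ, ContDiff ℝ (⊤ : ℕ∞) G ∧ HasCompactSupport G ∧
      (∀ x : ℝ, 0 ≤ G x ∧ G x ≤ C₁) ∧
      ∀ x : ℝ, (∀ y ∈ tsupport G, 1 ≤ |x - y|) →
        σ * ∫ y : ℝ, (G x - G y) / |x - y| ^ (1 + 2 * s) ≤ -C₂ * |x| ^ (-(1 + 2 * s)) := by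
  obtain ⟨p, hp⟩ : ∃ p, p = 1 + 2 * s := ⟨_, rfl⟩
  rw [← hp]
  have hp0 : 0 < p := by linarith
  have h2p : (0:ℝ) < 2 ^ p := by positivity
  obtain ⟨R, hR⟩ : ∃ R, R = C₂ * 2 ^ p / (2 * σ * C₁) := ⟨_, rfl⟩
  have hR0 : 0 < R := by rw [hR]; positivity
  let f : ContDiffBump (0:ℝ) := ⟨R, 2 * R, hR0, by linarith⟩
  have hG : ContDiff ℝ (⊤ : ℕ∞) (fun x => C₁ * f x) := contDiff_const.mul f.contDiff
  have hcs : HasCompactSupport (fun x => C₁ * f x) := f.hasCompactSupport.mul_left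
  have hts : tsupport (fun x => C₁ * f x) = Metric.closedBall 0 (2 * R) := by
    rw [← f.tsupport_eq, tsupport, tsupport]
    congr 1
    ext y
    simp [hC₁.ne']
  refine ⟨fun x => C₁ * f x, hG, hcs, fun x => ⟨mul_nonneg hC₁.le f.nonneg,
    mul_le_of_le_one_right hC₁.le f.le_one⟩, ?_⟩
  intro x hx
  rw [hts] at hx
  have hxR : 2 * R < |x| := by
    by_contra h
    have := hx x (by simpa using h)
    norm_num at this
  have hx0 : 0 < |x| := by linarith
  have hfx : f x = 0 := f.zero_of_le_dist (by simpa using hxR.le)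
  have hf0 : ∀ y, 2 * R < |y| → f y = 0 := fun y hy => f.zero_of_le_dist (by simpa using hy.le)
  have hint : Integrable (fun y => C₁ * f y / |x - y| ^ p) := by
    refine Integrable.mono' (hG.continuous.integrable_of_hasCompactSupport hcs) ?_ ?_
    · refine Measurable.aestronglyMeasurable ?_
      exact hG.continuous.measurable.div
        ((measurable_const.sub measurable_id).abs.pow_const p)
    · refine Filter.Eventually.of_forall fun y => ?_
      have h0 : 0 ≤ C₁ * f y := mul_nonneg hC₁.le f.nonneg
      rw [Real.norm_of_nonneg (by positivity)]
      by_cases hy : 2 * R < |y|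
      · simp [hf0 y hy]
      · have h1 := hx y (by simpa using hy)
        exact div_le_self h0 (Real.one_le_rpow h1 hp0.le)
  have hxp : 0 < |x| ^ p := by positivity
  have hlow : C₁ / (2 ^ p * |x| ^ p) * (2 * R) ≤ ∫ y, C₁ * f y / |x - y| ^ p := by
    have h1 : ∫ y, (Metric.closedBall (0:ℝ) R).indicator
        (fun _ => C₁ / (2 ^ p * |x| ^ p)) y = C₁ / (2 ^ p * |x| ^ p) * (2 * R) := by
      rw [integral_indicator_const _ Metric.isClosed_closedBall.measurableSet, measureReal_def,
        Real.volume_closedBall, ENNReal.toReal_ofReal (by linarith), smul_eq_mul, mul_comm]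
    rw [← h1]
    refine integral_mono ?_ hint ?_
    · exact (integrable_indicator_iff Metric.isClosed_closedBall.measurableSet).2
        (integrableOn_const (by rw [Real.volume_closedBall]; exact ENNReal.ofReal_ne_top))
    · intro y
      by_cases hy : y ∈ Metric.closedBall (0:ℝ) R
      · have hfy : f y = 1 := f.one_of_mem_closedBall hy
        have hyR : |y| ≤ R := by simpa using hy
        have hxy : 1 ≤ |x - y| := hx y (by simp; linarith)
        simp only [Set.indicator_of_mem hy, hfy, mul_one]
        rw [← Real.mul_rpow (by norm_num) hx0.le]
        have : |x - y| ≤ 2 * |x| := by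
          have := abs_sub x y
          linarith
        have h3 : 0 < |x - y| := by linarith
        gcongr
      · simp only [Set.indicator_of_notMem hy]
        have h0 : 0 ≤ C₁ * f y := mul_nonneg hC₁.le f.nonneg
        positivity
  have heq : ∫ y, (C₁ * f x - C₁ * f y) / |x - y| ^ p = - ∫ y, C₁ * f y / |x - y| ^ p := by
    rw [← integral_neg]
    congr 1
    ext y
    rw [hfx]
    ring
  have hfin : σ * (C₁ / (2 ^ p * |x| ^ p) * (2 * R)) = C₂ * |x| ^ (-p) := by
    rw [Real.rpow_neg hx0.le, hR]
    field_simp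
  have := mul_le_mul_of_nonneg_left hlow hσ.le
  simp only [heq]
  linarith
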